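/- arXiv:2505.00331 — 5 statements merged into one kernel-verified Lean document; each statement's English description precedes it below -/
import Mathlib

section
/- Let (M,d) be a metric space, let 1 ≤ T_0 < T be integers and J ≥ 1, let U_1, …, U_{J+1} ∈ M and let g_t : M → M for t = 1, …, T be maps, and set Y_{j,t}(N) = g_t(U_j). Assume that for every weight vector w ∈ Δ^{J-1} and every t = 1, …, T there exists a unique weighted Fréchet mean g_t^{(w)}(U_{2:J+1}) of the points g_t(U_2), …, g_t(U_{J+1}) with weights w. Define W_t* = {w ∈ Δ^{J-1} : d(g_t(U_1), g_t^{(w)}(U_{2:J+1})) = 0}. Assume ∩_{t=1}^{T_0} W_t* is nonempty and ∩_{t=1}^{T_0} W_t* ⊆ ∩_{t=T_0+1}^{T} W_t*. Then for any w̄ minimizing over w ∈ Δ^{J-1} the quantity (1/T_0) Σ_{t=1}^{T_0} d²(g_t(U_1), g_t^{(w)}(U_{2:J+1})), the geodesic synthetic control outcome Y_{1,t}^{(GSC)} = g_t^{(w̄)}(U_{2:J+1}) satisfies Y_{1,t}^{(GSC)} = Y_{1,t}(N) for each t = T_0+1, …, T. -/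
/-- Theorem 3.1 of the paper: identification of the geodesic synthetic
control method.  Outcomes are `Y_{j,t}(N) = g t (U j)` in a metric space `M`.  The treated
unit is `U₁` and the `J` control units are `U j`.  For each weight vector `w` in the simplex
and each time `t ∈ {1, …, T}`, `F w t` is the unique weighted Fréchet mean of the control
outcomes `g t (U j)` with weights `w`.  If the sets `W*_t` of perfectly fitting weights have a
common element over the pre-treatment periods `t = 1, …, T₀` and this intersection is contained
in the corresponding intersection over post-treatment periods, then for any minimizer `w̄` of
the mean squared pre-treatment discrepancy, the synthetic control outcome `F w̄ t` equals the
untreated potential outcome `g t U₁` at every post-treatment time `t`. -/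
theorem stmt_1 {M : Type*} [MetricSpace M]
    (T₀ T J : ℕ) (hT₀ : 1 ≤ T₀) (hT : T₀ < T) (hJ : 1 ≤ J)
    (U₁ : M) (U : Fin J → M) (g : ℕ → M → M)
    (F : (Fin J → ℝ) → ℕ → M)
    (hF : ∀ w ∈ stdSimplex ℝ (Fin J), ∀ t ∈ Finset.Icc 1 T,
      (∀ ν : M, ∑ j, w j * dist (F w t) (g t (U j)) ^ 2
          ≤ ∑ j, w j * dist ν (g t (U j)) ^ 2) ∧
      (∀ ν : M, (∀ ν' : M, ∑ j, w j * dist ν (g t (U j)) ^ 2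
          ≤ ∑ j, w j * dist ν' (g t (U j)) ^ 2) → ν = F w t))
    (Wstar : ℕ → Set (Fin J → ℝ))
    (hWstar : ∀ t, Wstar t
      = {w | w ∈ stdSimplex ℝ (Fin J) ∧ dist (g t U₁) (F w t) = 0})
    (hpre : (⋂ t ∈ Finset.Icc 1 T₀, Wstar t).Nonempty)
    (hsub : (⋂ t ∈ Finset.Icc 1 T₀, Wstar t) ⊆ ⋂ t ∈ Finset.Icc (T₀ + 1) T, Wstar t)
    (wbar : Fin J → ℝ) (hwbar : wbar ∈ stdSimplex ℝ (Fin J))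
    (hmin : ∀ w ∈ stdSimplex ℝ (Fin J),
      (T₀ : ℝ)⁻¹ * ∑ t ∈ Finset.Icc 1 T₀, dist (g t U₁) (F wbar t) ^ 2
        ≤ (T₀ : ℝ)⁻¹ * ∑ t ∈ Finset.Icc 1 T₀, dist (g t U₁) (F w t) ^ 2) :
    ∀ t ∈ Finset.Icc (T₀ + 1) T, F wbar t = g t U₁ := by
  obtain ⟨w, hw⟩ := hpre
  have hw' : ∀ t ∈ Finset.Icc 1 T₀,
      w ∈ stdSimplex ℝ (Fin J) ∧ dist (g t U₁) (F w t) = 0 := by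
    intro t ht
    have h := Set.mem_iInter₂.1 hw t ht
    rw [hWstar] at h
    exact h
  have hws := (hw' 1 (Finset.mem_Icc.2 ⟨le_refl _, hT₀⟩)).1
  have hz : ∑ t ∈ Finset.Icc 1 T₀, dist (g t U₁) (F w t) ^ 2 = 0 :=
    Finset.sum_eq_zero fun t ht => by rw [(hw' t ht).2]; norm_num
  have h1 := hmin w hws
  have hpos : (0 : ℝ) < (T₀ : ℝ)⁻¹ := inv_pos.2 (by exact_mod_cast hT₀)
  have h2 := le_of_mul_le_mul_left h1 hpos
  rw [hz] at h2
  have h3 : ∑ t ∈ Finset.Icc 1 T₀, dist (g t U₁) (F wbar t) ^ 2 = 0 :=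
    le_antisymm h2 (Finset.sum_nonneg fun t _ => sq_nonneg _)
  rw [Finset.sum_eq_zero_iff_of_nonneg (fun t _ => sq_nonneg _)] at h3
  have h4 : wbar ∈ ⋂ t ∈ Finset.Icc 1 T₀, Wstar t := by
    refine Set.mem_iInter₂.2 fun t ht => ?_
    rw [hWstar]
    exact ⟨hwbar, pow_eq_zero_iff (two_ne_zero) |>.1 (h3 t ht)⟩
  intro t ht
  have h5 := Set.mem_iInter₂.1 (hsub h4) t ht
  rw [hWstar] at h5
  exact (dist_eq_zero.1 h5.2).symm
end

section
/- Let (M,d) be a metric space, let 1 ≤ T_0 < T, J ≥ 1, points U_1, …, U_{J+1} ∈ M, V_1, …, V_T ∈ M and a map g : M × M → M. For λ ∈ Δ^{T_0-1} and w ∈ Δ^{J-1}, assume the following weighted Fréchet means exist and are unique: g^{(λ)}(U_j, V_{1:T_0}) (the weighted Fréchet mean of g(U_j, V_1), …, g(U_j, V_{T_0}) with weights λ), g^{(⊕)}(U_j, V_{T_0+1:T}) (the Fréchet mean of g(U_j, V_t), t = T_0+1, …, T, with uniform weights), g^{(w)}(U_{2:J+1}, V_t) (the weighted Fréchet mean of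 g(U_2, V_t), …, g(U_{J+1}, V_t) with weights w), g^{(w,λ)}(U_{2:J+1}, V_{1:T_0}) (the weighted Fréchet mean of g^{(λ)}(U_j, V_{1:T_0}), j = 2, …, J+1, with weights w), and g^{(w,⊕)}(U_{2:J+1}, V_{T_0+1:T}) (the weighted Fréchet mean of g^{(⊕)}(U_j, V_{T_0+1:T}), j = 2, …, J+1, with weights w). Define W_t* = {w ∈ Δ^{J-1} : d(g(U_1, V_t), g^{(w)}(U_{2:J+1}, V_t)) = 0}, Λ_j* = argmin_{λ ∈ Δ^{T_0-1}} d(g^{(⊕)}(U_j, V_{T_0+1:T}), g^{(λ)}(U_j, V_{1:T_0})), W_λ* = {w : d(g^{(λ)}(U_1, V_{1:T_0}), g^{(w,λ)}(U_{2:J+1}, V_{1:T_0})) = 0} and W_⊕* = {w : d(g^{(⊕)}(U_1, V_{T_0+1:T}), g^{(w,⊕)}(U_{2:J+1}, V_{T_0+1:T})) = 0}. Assume ∩_{t=1}^{T_0} W_t* ≠ ∅, ∩_{j=2}^{J+1} Λ_j* ≠ ∅, and for every λ ∈ ∩_{j=2}^{J+1} Λ_j* one has ∩_{t=1}^{T_0}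 W_t* ⊆ W_λ* ∩ W_⊕*. Let w̄ minimize w ↦ (1/T_0) Σ_{t=1}^{T_0} d²(g(U_1, V_t), g^{(w)}(U_{2:J+1}, V_t)) over Δ^{J-1} and λ̄ minimize λ ↦ (1/J) Σ_{j=2}^{J+1} d²(g^{(⊕)}(U_j, V_{T_0+1:T}), g^{(λ)}(U_j, V_{1:T_0})) over Δ^{T_0-1}. Then g^{(w̄,λ̄)}(U_{2:J+1}, V_{1:T_0}) = g^{(λ̄)}(U_1, V_{1:T_0}) and g^{(w̄,⊕)}(U_{2:J+1}, V_{T_0+1:T}) = g^{(⊕)}(U_1, V_{T_0+1:T}). -/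
/-- `IsUMin f m` says that `m` is a minimizer of `f` and every minimizer of `f` equals `m`,
i.e. `m` is the unique minimizer of `f`. -/
def IsUMin {α : Type*} (f : α → ℝ) (m : α) : Prop :=
  (∀ x, f m ≤ f x) ∧ ∀ x, (∀ y, f x ≤ f y) → x = m

/-- key intermediate claim in the proof of Theorem S1, identification of
geodesic synthetic difference-in-differences under the synthetic-control Assumption S2.
Outcomes are `g (U j) (V t)` in a metric space.  `Gl u l` is the weighted Fréchet mean of
`g u (V t)`, `t = 1, …, T₀`, with time weights `l`; `Gp u` is the Fréchet mean of `g u (V t)`,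
`t = T₀+1, …, T`, with uniform weights; `Gw w t` is the weighted Fréchet mean of the control
outcomes at time `t` with unit weights `w`; `Gwl w l` and `Gwp w` are the weighted Fréchet
means of `Gl (U j) l` resp. `Gp (U j)` over the controls with weights `w`.  Under the
synthetic-control assumption, the optimal unit weights `w̄` and time weights `λ̄` jointly
reconstruct the treated unit's weighted pre-treatment and post-treatment Fréchet means. -/
theorem stmt_2 {M : Type*} [MetricSpace M]
    (T₀ T J : ℕ) (hT₀ : 1 ≤ T₀) (hT : T₀ < T) (hJ : 1 ≤ J)
    (U₁ : M) (U : Fin J → M) (V : ℕ → M) (g : M → M → M)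
    (ΔT : Set (ℕ → ℝ))
    (hΔT : ΔT = {l | (∀ t ∈ Finset.Icc 1 T₀, 0 ≤ l t) ∧ ∑ t ∈ Finset.Icc 1 T₀, l t = 1})
    (Gl : M → (ℕ → ℝ) → M) (Gp : M → M)
    (Gw : (Fin J → ℝ) → ℕ → M)
    (Gwl : (Fin J → ℝ) → (ℕ → ℝ) → M)
    (Gwp : (Fin J → ℝ) → M)
    (hGl : ∀ u : M, ∀ l ∈ ΔT,
      IsUMin (fun ν : M => ∑ t ∈ Finset.Icc 1 T₀, l t * dist ν (g u (V t)) ^ 2) (Gl u l))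
    (hGp : ∀ u : M,
      IsUMin (fun ν : M => ∑ t ∈ Finset.Icc (T₀ + 1) T,
        ((T : ℝ) - T₀)⁻¹ * dist ν (g u (V t)) ^ 2) (Gp u))
    (hGw : ∀ w ∈ stdSimplex ℝ (Fin J), ∀ t ∈ Finset.Icc 1 T,
      IsUMin (fun ν : M => ∑ j, w j * dist ν (g (U j) (V t)) ^ 2) (Gw w t))
    (hGwl : ∀ w ∈ stdSimplex ℝ (Fin J), ∀ l ∈ ΔT,
      IsUMin (fun ν : M => ∑ j, w j * dist ν (Gl (U j) l) ^ 2) (Gwl w l))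
    (hGwp : ∀ w ∈ stdSimplex ℝ (Fin J),
      IsUMin (fun ν : M => ∑ j, w j * dist ν (Gp (U j)) ^ 2) (Gwp w))
    (Wstar : ℕ → Set (Fin J → ℝ))
    (hW : ∀ t, Wstar t
      = {w | w ∈ stdSimplex ℝ (Fin J) ∧ dist (g U₁ (V t)) (Gw w t) = 0})
    (Λstar : M → Set (ℕ → ℝ))
    (hΛ : ∀ u : M, Λstar u
      = {l | l ∈ ΔT ∧ ∀ l' ∈ ΔT, dist (Gp u) (Gl u l) ≤ dist (Gp u) (Gl u l')})
    (Wl : (ℕ → ℝ) → Set (Fin J → ℝ)) (Wp : Set (Fin J → ℝ))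
    (hWl : ∀ l, Wl l
      = {w | w ∈ stdSimplex ℝ (Fin J) ∧ dist (Gl U₁ l) (Gwl w l) = 0})
    (hWp : Wp = {w | w ∈ stdSimplex ℝ (Fin J) ∧ dist (Gp U₁) (Gwp w) = 0})
    (hpre : (⋂ t ∈ Finset.Icc 1 T₀, Wstar t).Nonempty)
    (hΛne : (⋂ j, Λstar (U j)).Nonempty)
    (hsub : ∀ l ∈ ⋂ j, Λstar (U j),
      (⋂ t ∈ Finset.Icc 1 T₀, Wstar t) ⊆ Wl l ∩ Wp)
    (wbar : Fin J → ℝ) (hwbar : wbar ∈ stdSimplex ℝ (Fin J))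
    (hwmin : ∀ w ∈ stdSimplex ℝ (Fin J),
      (T₀ : ℝ)⁻¹ * ∑ t ∈ Finset.Icc 1 T₀, dist (g U₁ (V t)) (Gw wbar t) ^ 2
        ≤ (T₀ : ℝ)⁻¹ * ∑ t ∈ Finset.Icc 1 T₀, dist (g U₁ (V t)) (Gw w t) ^ 2)
    (lbar : ℕ → ℝ) (hlbar : lbar ∈ ΔT)
    (hlmin : ∀ l ∈ ΔT,
      (J : ℝ)⁻¹ * ∑ j, dist (Gp (U j)) (Gl (U j) lbar) ^ 2
        ≤ (J : ℝ)⁻¹ * ∑ j, dist (Gp (U j)) (Gl (U j) l) ^ 2) :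
    Gwl wbar lbar = Gl U₁ lbar ∧ Gwp wbar = Gp U₁ := by
  have hT₀' : (0 : ℝ) < (T₀ : ℝ)⁻¹ := inv_pos.mpr (by exact_mod_cast hT₀)
  have hJ' : (0 : ℝ) < (J : ℝ)⁻¹ := inv_pos.mpr (by exact_mod_cast hJ)
  have hw : wbar ∈ ⋂ t ∈ Finset.Icc 1 T₀, Wstar t := by
    obtain ⟨w₀, hw₀⟩ := hpre
    simp only [Set.mem_iInter, hW, Set.mem_setOf_eq] at hw₀ ⊢
    have h0 : ∑ t ∈ Finset.Icc 1 T₀, dist (g U₁ (V t)) (Gw w₀ t) ^ 2 = 0 :=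
      Finset.sum_eq_zero fun t ht => by rw [(hw₀ t ht).2]; norm_num
    have h1 := le_of_mul_le_mul_left
      (hwmin w₀ (hw₀ 1 (Finset.mem_Icc.mpr ⟨le_refl 1, hT₀⟩)).1) hT₀'
    rw [h0] at h1
    have h2 := le_antisymm h1 (Finset.sum_nonneg fun t _ => sq_nonneg _)
    rw [Finset.sum_eq_zero_iff_of_nonneg (fun t _ => sq_nonneg _)] at h2
    exact fun t ht => ⟨hwbar, pow_eq_zero_iff (two_ne_zero) |>.mp (h2 t ht)⟩
  have hl : lbar ∈ ⋂ j, Λstar (U j) := by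
    obtain ⟨l₀, hl₀⟩ := hΛne
    simp only [Set.mem_iInter, hΛ, Set.mem_setOf_eq] at hl₀ ⊢
    have h1 := le_of_mul_le_mul_left (hlmin l₀ (hl₀ ⟨0, hJ⟩).1) hJ'
    have hle : ∀ j ∈ Finset.univ, dist (Gp (U j)) (Gl (U j) l₀) ^ 2
        ≤ dist (Gp (U j)) (Gl (U j) lbar) ^ 2 := fun j _ =>
      pow_le_pow_left₀ dist_nonneg ((hl₀ j).2 lbar hlbar) 2
    have h2 := (Finset.sum_eq_sum_iff_of_le hle).mp (le_antisymm (Finset.sum_le_sum hle) h1)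
    intro j
    refine ⟨hlbar, fun l' hl' => ?_⟩
    have h3 := (pow_left_inj₀ dist_nonneg dist_nonneg two_ne_zero).mp (h2 j (Finset.mem_univ j))
    rw [← h3]
    exact (hl₀ j).2 l' hl'
  have h := hsub lbar hl hw
  rw [hWl, hWp] at h
  exact ⟨(dist_eq_zero.mp h.1.2).symm, (dist_eq_zero.mp h.2.2).symm⟩
end

section
/- Let H be a real Hilbert space, let 1 ≤ T_0 < T, J ≥ 1, and let Y_{j,t} ∈ H for j = 1, …, J+1 and t = 1, …, T be points (interpreted as untreated potential outcomes Y_{j,t} = g(U_j, V_t)). For λ ∈ Δ^{T_0-1} and w ∈ Δ^{J-1} define A_j(λ) = Σ_{t=1}^{T_0} λ_t Y_{j,t}, B_j = (1/(T−T_0)) Σ_{t=T_0+1}^{T} Y_{j,t}, W_t* = {w ∈ Δ^{J-1} : Y_{1,t} = Σ_{j=2}^{J+1} w_j Y_{j,t}}, Λ_j* = argmin_{λ ∈ Δ^{T_0-1}} ‖B_j − A_j(λ)‖, W_λ* = {w : A_1(λ) = Σ_{j=2}^{J+1} w_j A_j(λ)} and W_⊕* = {w : B_1 = Σ_{j=2}^{J+1}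 w_j B_j}. Assume ∩_{t=1}^{T_0} W_t* ≠ ∅, ∩_{j=2}^{J+1} Λ_j* ≠ ∅, and for every λ ∈ ∩_{j=2}^{J+1} Λ_j* one has ∩_{t=1}^{T_0} W_t* ⊆ W_λ* ∩ W_⊕*. Let w̄ minimize w ↦ (1/T_0) Σ_{t=1}^{T_0} ‖Y_{1,t} − Σ_{j=2}^{J+1} w_j Y_{j,t}‖² over Δ^{J-1} and λ̄ minimize λ ↦ (1/J) Σ_{j=2}^{J+1} ‖B_j − A_j(λ)‖² over Δ^{T_0-1}. Then the synthetic difference-in-differences point A_1(λ̄) + (Σ_{j=2}^{J+1} w̄_j B_j − Σ_{j=2}^{J+1} w̄_j A_j(λ̄)) equals B_1. -/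
/-- Hilbert-space instance of Theorem S1 under the synthetic-control
Assumption S2.  In a real Hilbert space, weighted Fréchet means are weighted averages and the
geodesic transport map is translation, so the geodesic synthetic difference-in-differences
point takes the displayed additive form and equals the treated unit's post-treatment average
`B₁`. -/
theorem stmt_3 {H : Type*} [NormedAddCommGroup H] [InnerProductSpace ℝ H] [CompleteSpace H]
    (T₀ T J : ℕ) (hT₀ : 1 ≤ T₀) (hT : T₀ < T) (hJ : 1 ≤ J)
    (Y₁ : ℕ → H) (Y : Fin J → ℕ → H)
    (A₁ : (ℕ → ℝ) → H) (A : Fin J → (ℕ → ℝ) → H) (B₁ : H) (B : Fin J → H)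
    (hA₁ : ∀ l, A₁ l = ∑ t ∈ Finset.Icc 1 T₀, l t • Y₁ t)
    (hA : ∀ j l, A j l = ∑ t ∈ Finset.Icc 1 T₀, l t • Y j t)
    (hB₁ : B₁ = ((T : ℝ) - T₀)⁻¹ • ∑ t ∈ Finset.Icc (T₀ + 1) T, Y₁ t)
    (hB : ∀ j, B j = ((T : ℝ) - T₀)⁻¹ • ∑ t ∈ Finset.Icc (T₀ + 1) T, Y j t)
    (ΔT : Set (ℕ → ℝ))
    (hΔT : ΔT = {l | (∀ t ∈ Finset.Icc 1 T₀, 0 ≤ l t) ∧ ∑ t ∈ Finset.Icc 1 T₀, l t = 1})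
    (Wstar : ℕ → Set (Fin J → ℝ))
    (hW : ∀ t, Wstar t = {w | w ∈ stdSimplex ℝ (Fin J) ∧ Y₁ t = ∑ j, w j • Y j t})
    (Λ : Fin J → Set (ℕ → ℝ))
    (hΛ : ∀ j, Λ j = {l | l ∈ ΔT ∧ ∀ l' ∈ ΔT, ‖B j - A j l‖ ≤ ‖B j - A j l'‖})
    (Wl : (ℕ → ℝ) → Set (Fin J → ℝ)) (Wp : Set (Fin J → ℝ))
    (hWl : ∀ l, Wl l = {w | w ∈ stdSimplex ℝ (Fin J) ∧ A₁ l = ∑ j, w j • A j l})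
    (hWp : Wp = {w | w ∈ stdSimplex ℝ (Fin J) ∧ B₁ = ∑ j, w j • B j})
    (hpre : (⋂ t ∈ Finset.Icc 1 T₀, Wstar t).Nonempty)
    (hΛne : (⋂ j, Λ j).Nonempty)
    (hsub : ∀ l ∈ ⋂ j, Λ j, (⋂ t ∈ Finset.Icc 1 T₀, Wstar t) ⊆ Wl l ∩ Wp)
    (wbar : Fin J → ℝ) (hwbar : wbar ∈ stdSimplex ℝ (Fin J))
    (hwmin : ∀ w ∈ stdSimplex ℝ (Fin J),
      (T₀ : ℝ)⁻¹ * ∑ t ∈ Finset.Icc 1 T₀, ‖Y₁ t - ∑ j, wbar j • Y j t‖ ^ 2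
        ≤ (T₀ : ℝ)⁻¹ * ∑ t ∈ Finset.Icc 1 T₀, ‖Y₁ t - ∑ j, w j • Y j t‖ ^ 2)
    (lbar : ℕ → ℝ) (hlbar : lbar ∈ ΔT)
    (hlmin : ∀ l ∈ ΔT,
      (J : ℝ)⁻¹ * ∑ j, ‖B j - A j lbar‖ ^ 2 ≤ (J : ℝ)⁻¹ * ∑ j, ‖B j - A j l‖ ^ 2) :
    A₁ lbar + (∑ j, wbar j • B j - ∑ j, wbar j • A j lbar) = B₁ := by
  obtain ⟨w, hw⟩ := hpre
  obtain ⟨l, hl⟩ := hΛne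
  simp only [Set.mem_iInter] at hw
  have hw' : ∀ t ∈ Finset.Icc 1 T₀, w ∈ stdSimplex ℝ (Fin J) ∧ Y₁ t = ∑ j, w j • Y j t := by
    intro t ht
    have h := hw t ht
    rw [hW] at h
    exact h
  have hws : w ∈ stdSimplex ℝ (Fin J) := (hw' 1 (by simp [hT₀])).1
  have h0 : ∑ t ∈ Finset.Icc 1 T₀, ‖Y₁ t - ∑ j, w j • Y j t‖ ^ 2 = 0 := by
    apply Finset.sum_eq_zero
    intro t ht
    rw [← (hw' t ht).2]
    simp
  have hmin := hwmin w hws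
  rw [h0] at hmin
  have hpos : (0 : ℝ) < (T₀ : ℝ)⁻¹ := by
    have : (0 : ℝ) < T₀ := by exact_mod_cast hT₀
    positivity
  have hle := le_of_mul_le_mul_left hmin hpos
  have hz : ∑ t ∈ Finset.Icc 1 T₀, ‖Y₁ t - ∑ j, wbar j • Y j t‖ ^ 2 = 0 :=
    le_antisymm hle (Finset.sum_nonneg fun _ _ => by positivity)
  rw [Finset.sum_eq_zero_iff_of_nonneg (fun _ _ => by positivity)] at hz
  have hY : ∀ t ∈ Finset.Icc 1 T₀, Y₁ t = ∑ j, wbar j • Y j t := by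
    intro t ht
    have h := hz t ht
    rw [sq_eq_zero_iff, norm_eq_zero, sub_eq_zero] at h
    exact h
  have hmem : wbar ∈ ⋂ t ∈ Finset.Icc 1 T₀, Wstar t := by
    simp only [Set.mem_iInter]
    intro t ht
    rw [hW]
    exact ⟨hwbar, hY t ht⟩
  have hp := (hsub l hl hmem).2
  rw [hWp] at hp
  have hAeq : A₁ lbar = ∑ j, wbar j • A j lbar := by
    rw [hA₁]
    simp only [hA, Finset.smul_sum]
    rw [Finset.sum_comm]
    refine Finset.sum_congr rfl fun t ht => ?_
    rw [hY t ht, Finset.smul_sum]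
    exact Finset.sum_congr rfl fun j _ => smul_comm _ _ _
  rw [hAeq, ← hp.2]
  abel
end

section
/- Let H be a real Hilbert space, let 1 ≤ T_0 < T, J ≥ 1, and let Y_{j,t} ∈ H for j = 1, …, J+1 and t = 1, …, T. For λ ∈ Δ^{T_0-1} and w ∈ Δ^{J-1} define A_j(λ) = Σ_{t=1}^{T_0} λ_t Y_{j,t}, B_j = (1/(T−T_0)) Σ_{t=T_0+1}^{T} Y_{j,t}, W_t* = {w ∈ Δ^{J-1} : Y_{1,t} = Σ_{j=2}^{J+1} w_j Y_{j,t}} and Λ_j* = argmin_{λ ∈ Δ^{T_0-1}} ‖B_j − A_j(λ)‖. Assume: (i) ∩_{j=2}^{J+1} Λ_j* is nonempty and ∩_{j=2}^{J+1} Λ_j* ⊆ Λ_1*; (ii) ∩_{t=1}^{T_0} W_t* is nonempty, and for every w ∈ ∩_{t=1}^{T_0} W_t*, every λ_2 ∈ ∩_{j=2}^{J+1} Λ_j* and every λ_1 ∈ Λ_1*, the parallel-trend identity A_1(λ_1) + (Σ_{j=2}^{J+1} w_j B_j − Σ_{j=2}^{J+1} w_j A_j(λ_2)) = B_1 holds.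 Let w̄ minimize w ↦ (1/T_0) Σ_{t=1}^{T_0} ‖Y_{1,t} − Σ_{j=2}^{J+1} w_j Y_{j,t}‖² over Δ^{J-1} and λ̄ minimize λ ↦ (1/J) Σ_{j=2}^{J+1} ‖B_j − A_j(λ)‖² over Δ^{T_0-1}. Then A_1(λ̄) + (Σ_{j=2}^{J+1} w̄_j B_j − Σ_{j=2}^{J+1} w̄_j A_j(λ̄)) = B_1. -/
/-- Hilbert-space instance of Theorem S1 under the parallel-trend
Assumption S3, exhibiting the double robustness of the geodesic synthetic
difference-in-differences estimator.  In a real Hilbert space, weighted Fréchet means are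
weighted averages and the geodesic transport map is translation.  Under the parallel-trend
assumption, the synthetic difference-in-differences point equals the treated unit's
post-treatment average `B₁`. -/
theorem stmt_4 {H : Type*} [NormedAddCommGroup H] [InnerProductSpace ℝ H] [CompleteSpace H]
    (T₀ T J : ℕ) (hT₀ : 1 ≤ T₀) (hT : T₀ < T) (hJ : 1 ≤ J)
    (Y₁ : ℕ → H) (Y : Fin J → ℕ → H)
    (A₁ : (ℕ → ℝ) → H) (A : Fin J → (ℕ → ℝ) → H) (B₁ : H) (B : Fin J → H)
    (hA₁ : ∀ l, A₁ l = ∑ t ∈ Finset.Icc 1 T₀, l t • Y₁ t)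
    (hA : ∀ j l, A j l = ∑ t ∈ Finset.Icc 1 T₀, l t • Y j t)
    (hB₁ : B₁ = ((T : ℝ) - T₀)⁻¹ • ∑ t ∈ Finset.Icc (T₀ + 1) T, Y₁ t)
    (hB : ∀ j, B j = ((T : ℝ) - T₀)⁻¹ • ∑ t ∈ Finset.Icc (T₀ + 1) T, Y j t)
    (ΔT : Set (ℕ → ℝ))
    (hΔT : ΔT = {l | (∀ t ∈ Finset.Icc 1 T₀, 0 ≤ l t) ∧ ∑ t ∈ Finset.Icc 1 T₀, l t = 1})
    (Wstar : ℕ → Set (Fin J → ℝ))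
    (hW : ∀ t, Wstar t = {w | w ∈ stdSimplex ℝ (Fin J) ∧ Y₁ t = ∑ j, w j • Y j t})
    (Λ₁ : Set (ℕ → ℝ)) (Λ : Fin J → Set (ℕ → ℝ))
    (hΛ₁ : Λ₁ = {l | l ∈ ΔT ∧ ∀ l' ∈ ΔT, ‖B₁ - A₁ l‖ ≤ ‖B₁ - A₁ l'‖})
    (hΛ : ∀ j, Λ j = {l | l ∈ ΔT ∧ ∀ l' ∈ ΔT, ‖B j - A j l‖ ≤ ‖B j - A j l'‖})
    (hΛne : (⋂ j, Λ j).Nonempty)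
    (hΛsub : (⋂ j, Λ j) ⊆ Λ₁)
    (hpre : (⋂ t ∈ Finset.Icc 1 T₀, Wstar t).Nonempty)
    (hparallel : ∀ w ∈ ⋂ t ∈ Finset.Icc 1 T₀, Wstar t, ∀ l₂ ∈ ⋂ j, Λ j, ∀ l₁ ∈ Λ₁,
      A₁ l₁ + (∑ j, w j • B j - ∑ j, w j • A j l₂) = B₁)
    (wbar : Fin J → ℝ) (hwbar : wbar ∈ stdSimplex ℝ (Fin J))
    (hwmin : ∀ w ∈ stdSimplex ℝ (Fin J),
      (T₀ : ℝ)⁻¹ * ∑ t ∈ Finset.Icc 1 T₀, ‖Y₁ t - ∑ j, wbar j • Y j t‖ ^ 2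
        ≤ (T₀ : ℝ)⁻¹ * ∑ t ∈ Finset.Icc 1 T₀, ‖Y₁ t - ∑ j, w j • Y j t‖ ^ 2)
    (lbar : ℕ → ℝ) (hlbar : lbar ∈ ΔT)
    (hlmin : ∀ l ∈ ΔT,
      (J : ℝ)⁻¹ * ∑ j, ‖B j - A j lbar‖ ^ 2 ≤ (J : ℝ)⁻¹ * ∑ j, ‖B j - A j l‖ ^ 2) :
    A₁ lbar + (∑ j, wbar j • B j - ∑ j, wbar j • A j lbar) = B₁ := by
  have hw : wbar ∈ ⋂ t ∈ Finset.Icc 1 T₀, Wstar t := by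
    obtain ⟨w, hw⟩ := hpre
    simp only [Set.mem_iInter, hW, Set.mem_setOf_eq] at hw ⊢
    have h1 := hw 1 (Finset.mem_Icc.mpr ⟨le_refl 1, hT₀⟩)
    have h2 := hwmin w h1.1
    have h0 : ∑ t ∈ Finset.Icc 1 T₀, ‖Y₁ t - ∑ j, w j • Y j t‖ ^ 2 = 0 := by
      apply Finset.sum_eq_zero
      intro t ht
      rw [← (hw t ht).2]
      simp
    have hpos : (0 : ℝ) < (T₀ : ℝ)⁻¹ := inv_pos.mpr (by exact_mod_cast hT₀)
    have h3 := le_of_mul_le_mul_left h2 hpos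
    rw [h0] at h3
    have hnn : ∀ t ∈ Finset.Icc 1 T₀, 0 ≤ ‖Y₁ t - ∑ j, wbar j • Y j t‖ ^ 2 :=
      fun t _ => sq_nonneg _
    have h4 := (Finset.sum_eq_zero_iff_of_nonneg hnn).mp
      (le_antisymm h3 (Finset.sum_nonneg hnn))
    intro t ht
    refine ⟨hwbar, ?_⟩
    have h5 := h4 t ht
    exact sub_eq_zero.mp (norm_eq_zero.mp (pow_eq_zero_iff two_ne_zero |>.mp h5))
  have hl : lbar ∈ ⋂ j, Λ j := by
    obtain ⟨l, hl⟩ := hΛne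
    simp only [Set.mem_iInter, hΛ, Set.mem_setOf_eq] at hl ⊢
    have hlΔ : l ∈ ΔT := (hl ⟨0, hJ⟩).1
    have hpos : (0 : ℝ) < (J : ℝ)⁻¹ := inv_pos.mpr (by exact_mod_cast hJ)
    have h3 := le_of_mul_le_mul_left (hlmin l hlΔ) hpos
    have hle : ∀ j ∈ Finset.univ, ‖B j - A j l‖ ^ 2 ≤ ‖B j - A j lbar‖ ^ 2 := fun j _ =>
      pow_le_pow_left₀ (norm_nonneg _) ((hl j).2 lbar hlbar) 2
    have h4 := (Finset.sum_eq_sum_iff_of_le hle).mp (le_antisymm (Finset.sum_le_sum hle) h3)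
    intro j
    refine ⟨hlbar, fun l' hl' => ?_⟩
    have h5 := (pow_left_inj₀ (norm_nonneg _) (norm_nonneg _) two_ne_zero).mp
      (h4 j (Finset.mem_univ j))
    rw [← h5]
    exact (hl j).2 l' hl'
  exact hparallel wbar hw lbar hl lbar (hΛsub hl)
end

section
/- Let p > 0 and let U_1, …, U_{J+1} and μ_t (t = 1, …, T) be n×n real symmetric positive definite matrices, let α_t ∈ (0,1), and define the power distance d_{F,p}(A,B) = ‖A^p − B^p‖_F, where A^p = U Λ^p U' is the matrix power defined through the spectral decomposition A = UΛU' and ‖·‖_F is the Frobenius norm. Define g_t(U) = ((1 − α_t) μ_t^p + α_t U^p)^{1/p} and, for w ∈ Δ^{J-1}, M_w = (Σ_{j=2}^{J+1} w_j U_j^p)^{1/p} (both well defined since convex combinations of symmetric positive definite matrices are symmetric positive definite). Then: (i) g_t(M_w) is the unique minimizer over symmetric positive definite ν of Σ_{j=2}^{J+1} w_j d_{F,p}²(ν, g_t(U_j)); (ii) d_{F,p}(g_t(U_1), g_t(M_w)) = α_t d_{F,p}(U_1, M_w); and consequently (iii) for every t, {w ∈ Δ^{J-1} : d_{F,p}(g_t(U_1),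 g_t(M_w)) = 0} = {w ∈ Δ^{J-1} : d_{F,p}(U_1, M_w) = 0}, a set not depending on t. -/
noncomputable section

/-- The Frobenius norm of a real square matrix. -/
def frobNorm {n : ℕ} (A : Matrix (Fin n) (Fin n) ℝ) : ℝ :=
  Real.sqrt (∑ i, ∑ j, (A i j) ^ 2)

/-- The matrix power `A^q` for a real exponent `q`, obtained by applying the real power
`x ↦ x ^ q` to the eigenvalues in a spectral decomposition (realized via the continuous
functional calculus for selfadjoint matrices). -/
def matPow {n : ℕ} (A : Matrix (Fin n) (Fin n) ℝ) (q : ℝ) : Matrix (Fin n) (Fin n) ℝ :=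
  cfc (fun x : ℝ => x ^ q) A

/-- The power distance `d_{F,p}(A,B) = ‖A^p − B^p‖_F` on symmetric positive definite
matrices. -/
def dFp {n : ℕ} (p : ℝ) (A B : Matrix (Fin n) (Fin n) ℝ) : ℝ :=
  frobNorm (matPow A p - matPow B p)

theorem aux_posDef_spec {n : ℕ} {A : Matrix (Fin n) (Fin n) ℝ} (hA : A.PosDef) :
    IsSelfAdjoint A ∧ ∀ x ∈ spectrum ℝ A, 0 < x := by
  refine ⟨hA.1, ?_⟩
  rw [hA.1.spectrum_real_eq_range_eigenvalues]
  rintro _ ⟨i, rfl⟩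
  exact hA.eigenvalues_pos i

theorem aux_cont {n : ℕ} {A : Matrix (Fin n) (Fin n) ℝ} (hA : A.PosDef) (q : ℝ) :
    ContinuousOn (fun x : ℝ => x ^ q) (spectrum ℝ A) := fun x hx =>
  (Real.continuousAt_rpow_const x q
    (Or.inl ((aux_posDef_spec hA).2 x hx).ne')).continuousWithinAt

theorem aux_matPow_posDef {n : ℕ} {A : Matrix (Fin n) (Fin n) ℝ} (hA : A.PosDef) (q : ℝ) :
    (matPow A q).PosDef := by
  obtain ⟨h1, h2⟩ := aux_posDef_spec hA
  have hs : IsSelfAdjoint (matPow A q) := cfc_predicate _ A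
  have hh : (matPow A q).IsHermitian := hs
  rw [hh.posDef_iff_eigenvalues_pos]
  intro i
  have hi : hh.eigenvalues i ∈ spectrum ℝ (matPow A q) := by
    rw [hh.spectrum_real_eq_range_eigenvalues]; exact ⟨i, rfl⟩
  unfold matPow at hi
  rw [cfc_map_spectrum (fun x : ℝ => x ^ q) A h1 (aux_cont hA q)] at hi
  obtain ⟨x, hx, hxe⟩ := hi
  exact hxe ▸ Real.rpow_pos_of_pos (h2 x hx) q

theorem aux_matPow_matPow {n : ℕ} {A : Matrix (Fin n) (Fin n) ℝ} (hA : A.PosDef) {q r : ℝ}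
    (h : q * r = 1) : matPow (matPow A q) r = A := by
  obtain ⟨h1, h2⟩ := aux_posDef_spec hA
  unfold matPow
  rw [← cfc_comp' (fun x : ℝ => x ^ r) (fun x : ℝ => x ^ q) A ?_ (aux_cont hA q) h1]
  · have : Set.EqOn (fun x : ℝ => (x ^ q) ^ r) id (spectrum ℝ A) := fun x hx => by
      simp [← Real.rpow_mul (h2 x hx).le, h]
    rw [cfc_congr this, cfc_id ℝ A h1]
  · rintro _ ⟨x, hx, rfl⟩
    exact (Real.continuousAt_rpow_const _ r
      (Or.inl (Real.rpow_pos_of_pos (h2 x hx) q).ne')).continuousWithinAt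

theorem aux_frob_sq {n : ℕ} (A : Matrix (Fin n) (Fin n) ℝ) :
    frobNorm A ^ 2 = ∑ i, ∑ j, (A i j) ^ 2 :=
  Real.sq_sqrt (Finset.sum_nonneg fun _ _ => Finset.sum_nonneg fun _ _ => sq_nonneg _)

theorem aux_frob_eq_zero {n : ℕ} {A : Matrix (Fin n) (Fin n) ℝ}
    (h : frobNorm A ^ 2 = 0) : A = 0 := by
  rw [aux_frob_sq] at h
  ext i j
  have h1 := (Finset.sum_eq_zero_iff_of_nonneg (fun i _ =>
    Finset.sum_nonneg fun j _ => sq_nonneg (A i j))).1 h i (Finset.mem_univ _)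
  have h2 := (Finset.sum_eq_zero_iff_of_nonneg (fun j _ => sq_nonneg (A i j))).1 h1 j
    (Finset.mem_univ _)
  simpa using h2

theorem aux_frob_smul {n : ℕ} (A : Matrix (Fin n) (Fin n) ℝ) {c : ℝ} (hc : 0 ≤ c) :
    frobNorm (c • A) = c * frobNorm A := by
  unfold frobNorm
  have : ∑ i, ∑ j, ((c • A) i j) ^ 2 = c ^ 2 * ∑ i, ∑ j, (A i j) ^ 2 := by
    simp [Finset.mul_sum, mul_pow]
  rw [this, Real.sqrt_mul (sq_nonneg c), Real.sqrt_sq hc]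

theorem aux_scalar {J : ℕ} (w : Fin J → ℝ) (hw : ∑ j, w j = 1) (x : ℝ) (G : Fin J → ℝ) :
    ∑ j, w j * (x - G j) ^ 2 =
      ∑ j, w j * ((∑ k, w k * G k) - G j) ^ 2 + (x - ∑ k, w k * G k) ^ 2 := by
  set m := ∑ k, w k * G k with hm
  have e : ∀ j, w j * (x - G j) ^ 2 =
      w j * (m - G j) ^ 2 + (w j * (x ^ 2 - m ^ 2) - (2 * (x - m)) * (w j * G j)) := by
    intro j; ring
  rw [Finset.sum_congr rfl fun j _ => e j, Finset.sum_add_distrib, Finset.sum_sub_distrib,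
    ← Finset.sum_mul, ← Finset.mul_sum, hw, ← hm]
  ring

theorem aux_var {n J : ℕ} (w : Fin J → ℝ) (hw : ∑ j, w j = 1)
    (N : Matrix (Fin n) (Fin n) ℝ) (G : Fin J → Matrix (Fin n) (Fin n) ℝ) :
    ∑ j, w j * frobNorm (N - G j) ^ 2 =
      ∑ j, w j * frobNorm ((∑ k, w k • G k) - G j) ^ 2
        + frobNorm (N - ∑ k, w k • G k) ^ 2 := by
  have key : ∀ N : Matrix (Fin n) (Fin n) ℝ, ∑ j, w j * frobNorm (N - G j) ^ 2 =
      ∑ a, ∑ b, ∑ j, w j * (N a b - G j a b) ^ 2 := by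
    intro N
    simp only [aux_frob_sq, Finset.mul_sum, Matrix.sub_apply]
    rw [Finset.sum_comm]
    exact Finset.sum_congr rfl fun a _ => Finset.sum_comm
  rw [key, key, aux_frob_sq, ← Finset.sum_add_distrib]
  refine Finset.sum_congr rfl fun a _ => ?_
  rw [← Finset.sum_add_distrib]
  refine Finset.sum_congr rfl fun b _ => ?_
  simp only [Matrix.sub_apply, Matrix.sum_apply, Matrix.smul_apply, smul_eq_mul]
  exact aux_scalar w hw _ _

theorem aux_sum_posDef {n J : ℕ} (w : Fin J → ℝ) (hw : w ∈ stdSimplex ℝ (Fin J))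
    (G : Fin J → Matrix (Fin n) (Fin n) ℝ) (hG : ∀ j, (G j).PosDef) :
    (∑ j, w j • G j).PosDef := by
  obtain ⟨k, hk⟩ : ∃ k, 0 < w k := by
    by_contra! h
    have := Finset.sum_nonpos (s := Finset.univ) fun i _ => h i
    rw [hw.2] at this
    linarith
  rw [← Finset.add_sum_erase _ _ (Finset.mem_univ k)]
  exact ((hG k).smul hk).add_posSemidef
    (Matrix.posSemidef_sum _ fun j _ => (hG j).posSemidef.smul (hw.1 j))

/-- Supplement Section S.4.3: verification of the perfect-fit Assumption 3.1
for the geodesic model under the power metric family on symmetric positive definite matrices.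
With `g t U = ((1 − α t) μ t ^ p + α t U ^ p) ^ (1/p)` and
`M_w = (∑ j, w j U j ^ p) ^ (1/p)`: (i) `g t (M_w)` is the unique minimizer over positive
definite `ν` of `∑ j, w j * d_{F,p}(ν, g t (U j))²`;
(ii) `d_{F,p}(g t U₁, g t (M_w)) = α t * d_{F,p}(U₁, M_w)`; (iii) the perfect-fit weight set
at time `t` equals the `t`-independent set `{w : d_{F,p}(U₁, M_w) = 0}`. -/
theorem stmt_8 {n : ℕ} (p : ℝ) (hp : 0 < p) (T J : ℕ)
    (U₁ : Matrix (Fin n) (Fin n) ℝ) (hU₁ : U₁.PosDef)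
    (U : Fin J → Matrix (Fin n) (Fin n) ℝ) (hU : ∀ j, (U j).PosDef)
    (μ : ℕ → Matrix (Fin n) (Fin n) ℝ) (hμ : ∀ t ∈ Finset.Icc 1 T, (μ t).PosDef)
    (α : ℕ → ℝ) (hα : ∀ t ∈ Finset.Icc 1 T, α t ∈ Set.Ioo (0 : ℝ) 1)
    (g : ℕ → Matrix (Fin n) (Fin n) ℝ → Matrix (Fin n) (Fin n) ℝ)
    (hg : ∀ t A, g t A
      = matPow ((1 - α t) • matPow (μ t) p + α t • matPow A p) (1 / p))
    (Mw : (Fin J → ℝ) → Matrix (Fin n) (Fin n) ℝ)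
    (hMw : ∀ w, Mw w = matPow (∑ j, w j • matPow (U j) p) (1 / p)) :
    (∀ t ∈ Finset.Icc 1 T, ∀ w ∈ stdSimplex ℝ (Fin J),
      ((∀ ν : Matrix (Fin n) (Fin n) ℝ, ν.PosDef →
          ∑ j, w j * dFp p (g t (Mw w)) (g t (U j)) ^ 2
            ≤ ∑ j, w j * dFp p ν (g t (U j)) ^ 2) ∧
        (∀ ν : Matrix (Fin n) (Fin n) ℝ, ν.PosDef →
          (∀ ν' : Matrix (Fin n) (Fin n) ℝ, ν'.PosDef →
            ∑ j, w j * dFp p ν (g t (U j)) ^ 2 ≤ ∑ j, w j * dFp p ν' (g t (U j)) ^ 2) →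
          ν = g t (Mw w))) ∧
      dFp p (g t U₁) (g t (Mw w)) = α t * dFp p U₁ (Mw w)) ∧
    (∀ t ∈ Finset.Icc 1 T,
      {w | w ∈ stdSimplex ℝ (Fin J) ∧ dFp p (g t U₁) (g t (Mw w)) = 0}
        = {w | w ∈ stdSimplex ℝ (Fin J) ∧ dFp p U₁ (Mw w) = 0}) := by
  have pp : p * (1 / p) = 1 := by field_simp
  have pp' : (1 / p) * p = 1 := by field_simp
  have hK : ∀ t ∈ Finset.Icc 1 T, ∀ A : Matrix (Fin n) (Fin n) ℝ, A.PosDef →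
      ((1 - α t) • matPow (μ t) p + α t • matPow A p).PosDef := fun t ht A hA =>
    ((aux_matPow_posDef (hμ t ht) p).smul (sub_pos.2 (hα t ht).2)).add
      ((aux_matPow_posDef hA p).smul (hα t ht).1)
  have hgp : ∀ t ∈ Finset.Icc 1 T, ∀ A : Matrix (Fin n) (Fin n) ℝ, A.PosDef →
      matPow (g t A) p = (1 - α t) • matPow (μ t) p + α t • matPow A p := fun t ht A hA => by
    rw [hg, aux_matPow_matPow (hK t ht A hA) pp']
  have hgpd : ∀ t ∈ Finset.Icc 1 T, ∀ A : Matrix (Fin n) (Fin n) ℝ, A.PosDef →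
      (g t A).PosDef := fun t ht A hA => by
    rw [hg]; exact aux_matPow_posDef (hK t ht A hA) _
  have hS : ∀ w ∈ stdSimplex ℝ (Fin J), (∑ j, w j • matPow (U j) p).PosDef := fun w hw =>
    aux_sum_posDef w hw _ fun j => aux_matPow_posDef (hU j) p
  have hMpd : ∀ w ∈ stdSimplex ℝ (Fin J), (Mw w).PosDef := fun w hw => by
    rw [hMw]; exact aux_matPow_posDef (hS w hw) _
  have hMp : ∀ w ∈ stdSimplex ℝ (Fin J), matPow (Mw w) p = ∑ j, w j • matPow (U j) p :=
    fun w hw => by rw [hMw, aux_matPow_matPow (hS w hw) pp']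
  have h2 : ∀ t ∈ Finset.Icc 1 T, ∀ w ∈ stdSimplex ℝ (Fin J),
      dFp p (g t U₁) (g t (Mw w)) = α t * dFp p U₁ (Mw w) := fun t ht w hw => by
    unfold dFp
    rw [hgp t ht _ hU₁, hgp t ht _ (hMpd w hw), ← aux_frob_smul _ (hα t ht).1.le,
      add_sub_add_left_eq_sub, smul_sub]
  have hbar : ∀ t ∈ Finset.Icc 1 T, ∀ w ∈ stdSimplex ℝ (Fin J),
      matPow (g t (Mw w)) p = ∑ j, w j • matPow (g t (U j)) p := fun t ht w hw => by
    have e : ∀ j, w j • matPow (g t (U j)) p =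
        w j • ((1 - α t) • matPow (μ t) p) + α t • (w j • matPow (U j) p) := fun j => by
      rw [hgp t ht _ (hU j), smul_add, smul_comm (w j) (α t)]
    rw [hgp t ht _ (hMpd w hw), hMp w hw, Finset.sum_congr rfl fun j _ => e j,
      Finset.sum_add_distrib, ← Finset.sum_smul, hw.2, one_smul, Finset.smul_sum]
  have hvar : ∀ t ∈ Finset.Icc 1 T, ∀ w ∈ stdSimplex ℝ (Fin J),
      ∀ ν : Matrix (Fin n) (Fin n) ℝ,
      ∑ j, w j * dFp p ν (g t (U j)) ^ 2 = ∑ j, w j * dFp p (g t (Mw w)) (g t (U j)) ^ 2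
        + frobNorm (matPow ν p - matPow (g t (Mw w)) p) ^ 2 := fun t ht w hw ν => by
    unfold dFp
    rw [hbar t ht w hw]
    exact aux_var w hw.2 _ _
  refine ⟨fun t ht w hw => ⟨⟨fun ν _ => ?_, fun ν hν hmin => ?_⟩, h2 t ht w hw⟩, fun t ht => ?_⟩
  · rw [hvar t ht w hw ν]
    exact le_add_of_nonneg_right (sq_nonneg _)
  · have hgM := hgpd t ht _ (hMpd w hw)
    have h := hmin _ hgM
    rw [hvar t ht w hw ν] at h
    have h0 : frobNorm (matPow ν p - matPow (g t (Mw w)) p) ^ 2 = 0 :=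
      le_antisymm (by linarith) (sq_nonneg _)
    have he := sub_eq_zero.1 (aux_frob_eq_zero h0)
    rw [← aux_matPow_matPow hν pp, he, aux_matPow_matPow hgM pp]
  · ext w
    simp only [Set.mem_ofPred_eq]
    refine and_congr_right fun hw => ?_
    rw [h2 t ht w hw, mul_eq_zero]
    exact or_iff_right (hα t ht).1.ne'


end
end
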